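/- arXiv:2105.13263 — 8 statements merged into one kernel-verified Lean document; each statement's English description precedes it below -/
import Mathlib

section
/- Let U be an open subset of the upper half-plane ℍ and let ξ : U → ℂ be a smooth vector field, written ξ = ξ¹ + i·ξ² with real-valued components ξ¹, ξ². Then ξ satisfies the harmonic vector field equations ∂²ξ¹/∂x² + ∂²ξ¹/∂y² − (2/y)·(∂ξ²/∂x + ∂ξ¹/∂y) = 0 and ∂²ξ²/∂x² + ∂²ξ²/∂y² + (2/y)·(∂ξ¹/∂x − ∂ξ²/∂y) = 0 at every point z = x + iy of U if and only if the function f : U → ℂ defined by f(z) = conj( (2/(Im z)²)·(∂ξ/∂z̄)(z) ) is holomorphic on U (f dz² is the (2,0)-part of the Lie derivative of the hyperbolic metric along ξ). -/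
/-- The Wirtinger derivative `∂f/∂z̄` of a function `f : ℂ → ℂ` at `z`,
defined as `½(D₁f(z) + i·D₂f(z))` where `D₁`, `D₂` are the real directional
derivatives in the directions `1` and `i`. -/
noncomputable def wirtingerDbar (f : ℂ → ℂ) (z : ℂ) : ℂ :=
  (1 / 2 : ℂ) * (fderiv ℝ f z 1 + Complex.I * fderiv ℝ f z Complex.I)

open Complex in
/-- The Cauchy–Riemann equations for a function given by its real and imaginary parts. -/
lemma differentiableAt_ofReal_add_I_mul_iff {u v : ℂ → ℝ} {z : ℂ}
    (hu : DifferentiableAt ℝ u z) (hv : DifferentiableAt ℝ v z) :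
    DifferentiableAt ℂ (fun w => (u w : ℂ) + I * (v w : ℂ)) z ↔
      fderiv ℝ u z 1 = fderiv ℝ v z I ∧ fderiv ℝ u z I = -fderiv ℝ v z 1 := by
  have h : HasFDerivAt (fun w => (u w : ℂ) + I * (v w : ℂ))
      (ofRealCLM.comp (fderiv ℝ u z) + I • ofRealCLM.comp (fderiv ℝ v z)) z :=
    (ofRealCLM.hasFDerivAt.comp z hu.hasFDerivAt).add
      ((ofRealCLM.hasFDerivAt.comp z hv.hasFDerivAt).const_mul I)
  rw [differentiableAt_complex_iff_differentiableAt_real, h.fderiv,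
    and_iff_right h.differentiableAt, Complex.ext_iff]
  simp [eq_comm, and_comm]

/-- The derivative of the quotient of a real function by the squared imaginary part. -/
lemma fderiv_div_im_sq_apply {g : ℂ → ℝ} {z : ℂ} (hz : z.im ≠ 0)
    (hg : DifferentiableAt ℝ g z) (v : ℂ) :
    fderiv ℝ (fun w => g w / w.im ^ 2) z v =
      (fderiv ℝ g z v - 2 / z.im * v.im * g z) / z.im ^ 2 := by
  have him : HasFDerivAt (fun w : ℂ => w.im) Complex.imCLM z := Complex.imCLM.hasFDerivAt
  have hinv := (((hasDerivAt_id z.im).pow 2).inv (pow_ne_zero 2 hz)).comp_hasFDerivAt z him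
  have h : HasFDerivAt (fun w => g w / w.im ^ 2) _ z := hg.hasFDerivAt.mul hinv
  rw [h.fderiv]
  simp
  field_simp
  ring

/-- The iterated directional derivative expressed through the second derivative. -/
lemma fderiv_fderiv_apply_eq {g : ℂ → ℝ} {z : ℂ} (hg : ContDiffAt ℝ 2 g z) (v w : ℂ) :
    fderiv ℝ (fun x => fderiv ℝ g x v) z w = fderiv ℝ (fderiv ℝ g) z w v := by
  have h : DifferentiableAt ℝ (fderiv ℝ g) z :=
    (hg.fderiv_right (m := 1) (by norm_num)).differentiableAt one_ne_zero
  rw [fderiv_clm_apply h (differentiableAt_const v)]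
  simp

/-- Directional derivatives of a twice continuously differentiable function are differentiable. -/
lemma differentiableAt_fderiv_apply {g : ℂ → ℝ} {z : ℂ} (hg : ContDiffAt ℝ 2 g z) (v : ℂ) :
    DifferentiableAt ℝ (fun x => fderiv ℝ g x v) z :=
  ((hg.fderiv_right (m := 1) (by norm_num)).differentiableAt one_ne_zero).clm_apply
    (differentiableAt_const v)

/-- Mixed directional derivatives commute. -/
lemma fderiv_fderiv_apply_comm {g : ℂ → ℝ} {z : ℂ} (hg : ContDiffAt ℝ 2 g z) (v w : ℂ) :
    fderiv ℝ (fun x => fderiv ℝ g x v) z w = fderiv ℝ (fun x => fderiv ℝ g x w) z v := by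
  rw [fderiv_fderiv_apply_eq hg, fderiv_fderiv_apply_eq hg]
  exact hg.isSymmSndFDerivAt (by simp) w v

/-- The coefficient `conj ((2 / (Im z)²) ∂ξ/∂z̄)` in terms of the components of `ξ`. -/
lemma conj_wirtingerDbar_eq {ξ1 ξ2 : ℂ → ℝ} {z : ℂ}
    (h1 : DifferentiableAt ℝ ξ1 z) (h2 : DifferentiableAt ℝ ξ2 z) :
    (starRingEnd ℂ) ((2 / (z.im : ℂ) ^ 2) *
        wirtingerDbar (fun w => (ξ1 w : ℂ) + Complex.I * (ξ2 w : ℂ)) z) =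
      (((fderiv ℝ ξ1 z 1 - fderiv ℝ ξ2 z Complex.I) / z.im ^ 2 : ℝ) : ℂ) +
        Complex.I * ((-(fderiv ℝ ξ2 z 1 + fderiv ℝ ξ1 z Complex.I) / z.im ^ 2 : ℝ) : ℂ) := by
  have h : HasFDerivAt (fun w => (ξ1 w : ℂ) + Complex.I * (ξ2 w : ℂ))
      (Complex.ofRealCLM.comp (fderiv ℝ ξ1 z) +
        Complex.I • Complex.ofRealCLM.comp (fderiv ℝ ξ2 z)) z :=
    (Complex.ofRealCLM.hasFDerivAt.comp z h1.hasFDerivAt).add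
      ((Complex.ofRealCLM.hasFDerivAt.comp z h2.hasFDerivAt).const_mul Complex.I)
  rw [wirtingerDbar, h.fderiv]
  simp only [add_apply, smul_apply,
    ContinuousLinearMap.comp_apply, Complex.ofRealCLM_apply, smul_eq_mul, map_mul, map_add,
    map_div₀, map_pow, Complex.conj_ofReal, Complex.conj_I, map_ofNat, map_one]
  push_cast
  linear_combination (-(fderiv ℝ ξ2 z Complex.I : ℂ) / (z.im : ℂ) ^ 2) * -Complex.I_sq

/-- A smooth vector field `ξ = ξ¹ + i ξ²` on an open subset `U` of the upper
half-plane satisfies the harmonic vector field equations at every point of `U`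
iff the associated quadratic differential coefficient
`f(z) = conj((2/(Im z)²)·∂ξ/∂z̄(z))` is holomorphic on `U`. -/
theorem statement0 (U : Set ℂ) (hUopen : IsOpen U) (hUH : U ⊆ {z : ℂ | 0 < z.im})
    (ξ : ℂ → ℂ) (ξ1 ξ2 : ℂ → ℝ)
    (hsmooth : ContDiffOn ℝ ((⊤ : ℕ∞) : WithTop ℕ∞) ξ U)
    (hdecomp : ∀ z, ξ z = (ξ1 z : ℂ) + Complex.I * (ξ2 z : ℂ)) :
    (∀ z ∈ U,
      fderiv ℝ (fun w => fderiv ℝ ξ1 w 1) z 1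
          + fderiv ℝ (fun w => fderiv ℝ ξ1 w Complex.I) z Complex.I
          - (2 / z.im) * (fderiv ℝ ξ2 z 1 + fderiv ℝ ξ1 z Complex.I) = 0 ∧
      fderiv ℝ (fun w => fderiv ℝ ξ2 w 1) z 1
          + fderiv ℝ (fun w => fderiv ℝ ξ2 w Complex.I) z Complex.I
          + (2 / z.im) * (fderiv ℝ ξ1 z 1 - fderiv ℝ ξ2 z Complex.I) = 0)
    ↔ DifferentiableOn ℂ
        (fun z => (starRingEnd ℂ) ((2 / (z.im : ℂ) ^ 2) * wirtingerDbar ξ z)) U := by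
  obtain rfl : ξ = fun z => (ξ1 z : ℂ) + Complex.I * (ξ2 z : ℂ) := funext hdecomp
  have hC : ∀ z ∈ U, ContDiffAt ℝ 2 ξ1 z ∧ ContDiffAt ℝ 2 ξ2 z := by
    intro z hz
    have h : ContDiffAt ℝ 2 (fun z => (ξ1 z : ℂ) + Complex.I * (ξ2 z : ℂ)) z :=
      (hsmooth.contDiffAt (hUopen.mem_nhds hz)).of_le (WithTop.coe_le_coe.2 le_top)
    have hre := Complex.reCLM.contDiff.contDiffAt.comp z h
    have him := Complex.imCLM.contDiff.contDiffAt.comp z h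
    constructor
    · convert hre using 1
      ext w
      simp
    · convert him using 1
      ext w
      simp
  refine forall₂_congr fun z hz => ?_
  obtain ⟨h1, h2⟩ := hC z hz
  have hy : z.im ≠ 0 := (hUH hz).ne'
  have d11 := differentiableAt_fderiv_apply h1 1
  have d1I := differentiableAt_fderiv_apply h1 Complex.I
  have d21 := differentiableAt_fderiv_apply h2 1
  have d2I := differentiableAt_fderiv_apply h2 Complex.I
  have hA := d11.fun_sub d2I
  have hB := (d21.fun_add d1I).fun_neg
  have him : DifferentiableAt ℝ (fun w : ℂ => w.im ^ 2) z :=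
    Complex.imCLM.differentiableAt.pow 2
  have hdiv {g : ℂ → ℝ} (hg : DifferentiableAt ℝ g z) :
      DifferentiableAt ℝ (fun w => g w / w.im ^ 2) z :=
    hg.mul (him.inv (pow_ne_zero 2 hy))
  have heq := Filter.eventuallyEq_of_mem (hUopen.mem_nhds hz) fun w hw =>
    conj_wirtingerDbar_eq ((hC w hw).1.differentiableAt two_ne_zero)
      ((hC w hw).2.differentiableAt two_ne_zero)
  refine Iff.trans ?_ ⟨DifferentiableAt.differentiableWithinAt,
    fun h => h.differentiableAt (hUopen.mem_nhds hz)⟩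
  rw [heq.differentiableAt_iff,
    differentiableAt_ofReal_add_I_mul_iff (hdiv hA) (hdiv hB),
    fderiv_div_im_sq_apply hy hA, fderiv_div_im_sq_apply hy hB,
    fderiv_div_im_sq_apply hy hA, fderiv_div_im_sq_apply hy hB,
    ← neg_div, div_left_inj' (pow_ne_zero 2 hy), div_left_inj' (pow_ne_zero 2 hy),
    fderiv_fun_neg, fderiv_fun_sub d11 d2I, fderiv_fun_add d21 d1I]
  simp only [neg_apply, add_apply,
    sub_apply, Complex.one_im, Complex.I_im,
    fderiv_fderiv_apply_comm h1 1 Complex.I, fderiv_fderiv_apply_comm h2 1 Complex.I]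
  constructor
  · rintro ⟨e1, e2⟩
    constructor <;> linarith
  · rintro ⟨e1, e2⟩
    constructor <;> linarith
end

section
/- (Local surjectivity in the short exact sequence HOL → HARM → HQD.) Let V be an open subset of the upper half-plane ℍ, let a ∈ V, and let f : V → ℂ be holomorphic. Then there exist an open set U with a ∈ U ⊆ V and a real-differentiable function ξ : U → ℂ such that ∂ξ/∂z̄(z) = ((Im z)²/2)·conj(f(z)) for every z ∈ U, and moreover ξ(a) = 0. In other words, every holomorphic quadratic differential f dz² on V is, near a, the quadratic differential associated to a harmonic vector field. -/
/-- If `g` has complex derivative `g'` at `z`, then `conj ∘ g` has real derivative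
`v ↦ conj (v * g')` there. -/
lemma hasFDerivAt_conj_comp {g : ℂ → ℂ} {g' z : ℂ} (hg : HasDerivAt g g' z) :
    HasFDerivAt (fun w => (starRingEnd ℂ) (g w))
      ((Complex.conjCLE : ℂ →L[ℝ] ℂ).comp
        ((ContinuousLinearMap.toSpanSingleton ℂ g').restrictScalars ℝ)) z :=
  (Complex.conjCLE : ℂ →L[ℝ] ℂ).hasFDerivAt.comp z (hg.hasFDerivAt.restrictScalars ℝ)

/-- The operator `∂/∂z̄` treats holomorphic factors as constants and sends `conj ∘ g` to
`conj ∘ g'`. -/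
lemma wirtingerDbar_mul_conj_add {p q A B C : ℂ → ℂ} {p' q' A' B' C' z : ℂ} (c : ℂ)
    (hp : HasDerivAt p p' z) (hq : HasDerivAt q q' z) (hA : HasDerivAt A A' z)
    (hB : HasDerivAt B B' z) (hC : HasDerivAt C C' z) :
    DifferentiableAt ℝ (fun w => p w * (starRingEnd ℂ) (A w) + q w * (starRingEnd ℂ) (B w)
        + (starRingEnd ℂ) (C w) - c) z ∧
      wirtingerDbar (fun w => p w * (starRingEnd ℂ) (A w) + q w * (starRingEnd ℂ) (B w)
        + (starRingEnd ℂ) (C w) - c) z =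
        p z * (starRingEnd ℂ) A' + q z * (starRingEnd ℂ) B' + (starRingEnd ℂ) C' := by
  have h := ((((hp.hasFDerivAt.restrictScalars ℝ).fun_mul (hasFDerivAt_conj_comp hA)).fun_add
    ((hq.hasFDerivAt.restrictScalars ℝ).fun_mul (hasFDerivAt_conj_comp hB))).fun_add
    (hasFDerivAt_conj_comp hC)).sub_const c
  refine ⟨h.differentiableAt, ?_⟩
  rw [wirtingerDbar, HasFDerivAt.fderiv h]
  simp
  linear_combination (-1 / 2 : ℂ) * (p z * (starRingEnd ℂ) A' + q z * (starRingEnd ℂ) B'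
    + (starRingEnd ℂ) C' - (starRingEnd ℂ) (A z) * p' - (starRingEnd ℂ) (B z) * q')
      * Complex.I_sq

/-- Local surjectivity in the short exact sequence `HOL → HARM → HQD`:
every holomorphic quadratic differential `f dz²` on an open `V ⊆ ℍ` is, near a
point `a ∈ V`, the quadratic differential of a harmonic vector field `ξ`
(normalized by `ξ(a) = 0`). -/
theorem statement1 (V : Set ℂ) (hV : IsOpen V) (hVH : V ⊆ {z : ℂ | 0 < z.im})
    (a : ℂ) (ha : a ∈ V) (f : ℂ → ℂ) (hf : DifferentiableOn ℂ f V) :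
    ∃ U : Set ℂ, IsOpen U ∧ a ∈ U ∧ U ⊆ V ∧
      ∃ ξ : ℂ → ℂ, ξ a = 0 ∧
        ∀ z ∈ U, DifferentiableAt ℝ ξ z ∧
          wirtingerDbar ξ z = ((z.im ^ 2 / 2 : ℝ) : ℂ) * (starRingEnd ℂ) (f z) := by
  obtain ⟨r, hr, hball⟩ := Metric.isOpen_iff.1 hV a ha
  have hfb := hf.mono hball
  obtain ⟨A, hA⟩ := hfb.isExactOn_ball
  obtain ⟨B, hB⟩ := (differentiableOn_id.mul hfb).isExactOn_ball
  obtain ⟨C, hC⟩ := (((differentiableOn_id.pow 2).mul hfb).const_mul (-1 / 8)).isExactOn_ball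
  let η : ℂ → ℂ := fun w => (-1 / 8 * w ^ 2) * (starRingEnd ℂ) (A w)
    + (1 / 4 * w) * (starRingEnd ℂ) (B w) + (starRingEnd ℂ) (C w)
  refine ⟨Metric.ball a r, Metric.isOpen_ball, Metric.mem_ball_self hr, hball,
    fun w => η w - η a, sub_self _, fun z hz => ?_⟩
  obtain ⟨hd, hw⟩ := wirtingerDbar_mul_conj_add (η a) (((hasDerivAt_id z).pow 2).const_mul (-1 / 8))
    ((hasDerivAt_id z).const_mul (1 / 4)) (hA z hz) (hB z hz) (hC z hz)
  refine ⟨hd, hw.trans ?_⟩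
  have him : ((z.im : ℝ) : ℂ) = (z - (starRingEnd ℂ) z) / (2 * Complex.I) :=
    Complex.im_eq_sub_conj z
  push_cast
  rw [him, div_pow, mul_pow, Complex.I_sq]
  have h8 : (starRingEnd ℂ) 8 = 8 := map_ofNat _ 8
  simp [h8]
  ring
end

section
/- (Wolpert's global solution of the potential equation.) Let f : ℍ → ℂ be holomorphic on the upper half-plane. Define ξ : ℍ → ℂ by ξ(z) = conj( (z − i) · ∫₀¹ (conj(z) − (i + t(z − i)))² · f(i + t(z − i)) dt ), i.e. ξ(z) is the complex conjugate of the path integral ∫ from i to z of (conj(z) − ζ)²·f(ζ) dζ along the straight segment from i to z (which lies in ℍ). Then for every z ∈ ℍ, ∂ξ/∂z̄(z) = (z − conj(z))² · conj(f(z)). -/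
open Complex Metric in
/-- Every point of the upper half-plane lies, together with `I`, in a Euclidean disk contained in
the upper half-plane. -/
theorem exists_ball_subset_upperHalfPlane {z : ℂ} (hz : 0 < z.im) :
    ∃ (c : ℂ) (r : ℝ), I ∈ ball c r ∧ z ∈ ball c r ∧ ball c r ⊆ {w : ℂ | 0 < w.im} := by
  set R : ℝ := (z.re ^ 2 + z.im ^ 2 + 1) / (2 * z.im) + 1 with hR
  have hR1 : 1 < R := by
    have : 0 < (z.re ^ 2 + z.im ^ 2 + 1) / (2 * z.im) := by positivity
    linarith
  have key : ∀ w : ℂ, w ∈ ball ((R : ℂ) * I) R ↔ w.re ^ 2 + w.im ^ 2 < 2 * R * w.im := by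
    intro w
    rw [mem_ball, dist_eq, ← sq_lt_sq₀ (norm_nonneg _) (by linarith), ← normSq_eq_norm_sq,
      normSq_apply]
    simp only [sub_re, sub_im, mul_re, mul_im, ofReal_re, ofReal_im, I_re, I_im]
    constructor <;> intro h <;> nlinarith
  refine ⟨R * I, R, (key I).2 (by simp; linarith), (key z).2 ?_, fun w hw => ?_⟩
  · have : 2 * R * z.im = z.re ^ 2 + z.im ^ 2 + 1 + 2 * z.im := by
      rw [hR]; field_simp
    linarith
  · have h := (key w).1 hw
    have : 0 < R * w.im := by
      rcases eq_or_ne w.im 0 with h0 | h0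
      · rw [h0] at h; nlinarith [sq_nonneg w.re]
      · nlinarith [sq_nonneg w.re, sq_nonneg w.im]
    exact pos_of_mul_pos_right this (by linarith)

/-- The integral of a derivative along a segment. -/
theorem mul_integral_segment_eq_sub {G g : ℂ → ℂ} {s : Set ℂ} (hs : Convex ℝ s) {a b : ℂ}
    (ha : a ∈ s) (hb : b ∈ s) (hG : ∀ w ∈ s, HasDerivAt G (g w) w) (hg : ContinuousOn g s) :
    (b - a) * ∫ t in (0 : ℝ)..1, g (a + (t : ℂ) * (b - a)) = G b - G a := by
  have hmem : ∀ t ∈ Set.uIcc (0 : ℝ) 1, a + (t : ℂ) * (b - a) ∈ s := by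
    intro t ht
    rw [Set.uIcc_of_le zero_le_one] at ht
    simpa using hs.add_smul_sub_mem ha hb ht
  have hγ : ∀ t : ℝ, HasDerivAt (fun t : ℝ => a + (t : ℂ) * (b - a)) (b - a) t := fun t => by
    simpa using ((Complex.ofRealCLM.hasDerivAt (x := t)).mul_const (b - a)).const_add a
  have hcont : ContinuousOn (fun t : ℝ => g (a + (t : ℂ) * (b - a))) (Set.uIcc 0 1) :=
    hg.comp (by fun_prop) hmem
  rw [← intervalIntegral.integral_const_mul,
    intervalIntegral.integral_eq_sub_of_hasDerivAt
      (f := fun t : ℝ => G (a + (t : ℂ) * (b - a)))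
      (f' := fun t : ℝ => (b - a) * g (a + (t : ℂ) * (b - a)))
      (fun t ht => by
        simpa [mul_comm, Function.comp_def] using (hG _ (hmem t ht)).scomp t (hγ t))
      (continuousOn_const.mul hcont).intervalIntegrable]
  simp

/-- The conjugate of a quadratic polynomial in `z̄` with holomorphic coefficients. -/
theorem wirtingerDbar_conj_quadratic {F₀ F₁ F₂ : ℂ → ℂ} {a₀ a₁ a₂ z : ℂ}
    (h₀ : HasDerivAt F₀ a₀ z) (h₁ : HasDerivAt F₁ a₁ z) (h₂ : HasDerivAt F₂ a₂ z) :
    wirtingerDbar (fun w => (starRingEnd ℂ) ((starRingEnd ℂ) w ^ 2 * F₀ w -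
        2 * (starRingEnd ℂ) w * F₁ w + F₂ w)) z =
      (starRingEnd ℂ) ((starRingEnd ℂ) z ^ 2 * a₀ - 2 * (starRingEnd ℂ) z * a₁ + a₂) := by
  have hc : HasFDerivAt (fun w : ℂ => (starRingEnd ℂ) w) (Complex.conjCLE : ℂ →L[ℝ] ℂ) z :=
    Complex.conjCLE.hasFDerivAt
  have hsum := (((hc.pow 2).mul h₀.complexToReal_fderiv).sub
    ((hc.const_mul 2).mul h₁.complexToReal_fderiv)).add h₂.complexToReal_fderiv
  have hξ := (Complex.conjCLE : ℂ →L[ℝ] ℂ).hasFDerivAt.comp z hsum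
  rw [wirtingerDbar, HasFDerivAt.fderiv (f := fun w => (starRingEnd ℂ)
    ((starRingEnd ℂ) w ^ 2 * F₀ w - 2 * (starRingEnd ℂ) w * F₁ w + F₂ w)) hξ]
  simp
  ring_nf
  simp
  ring

/-- Wolpert's global solution of the potential equation: for `f` holomorphic on
the upper half-plane, `ξ(z) = conj(∫_i^z (z̄ − ζ)² f(ζ) dζ)` (the path integral
along the segment from `i` to `z`) satisfies `∂ξ/∂z̄(z) = (z − z̄)²·conj(f(z))`. -/
theorem statement2 (f : ℂ → ℂ) (hf : DifferentiableOn ℂ f {z : ℂ | 0 < z.im})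
    (ξ : ℂ → ℂ)
    (hξ : ∀ z : ℂ, ξ z = (starRingEnd ℂ) ((z - Complex.I) *
        ∫ t in (0:ℝ)..1,
          ((starRingEnd ℂ) z - (Complex.I + (t : ℂ) * (z - Complex.I))) ^ 2 *
            f (Complex.I + (t : ℂ) * (z - Complex.I)))) :
    ∀ z : ℂ, 0 < z.im →
      wirtingerDbar ξ z = (z - (starRingEnd ℂ) z) ^ 2 * (starRingEnd ℂ) (f z) := by
  intro z hz
  obtain ⟨c, r, hI, hzb, hsub⟩ := exists_ball_subset_upperHalfPlane hz
  have hf' := hf.mono hsub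
  obtain ⟨F₀, hF₀I, hF₀⟩ := hf'.isExactOn_ball.with_val_at Complex.I 0
  obtain ⟨F₁, hF₁I, hF₁⟩ := (differentiableOn_id.mul hf').isExactOn_ball.with_val_at Complex.I 0
  obtain ⟨F₂, hF₂I, hF₂⟩ :=
    ((differentiableOn_id.pow 2).mul hf').isExactOn_ball.with_val_at Complex.I 0
  have hev : ξ =ᶠ[nhds z] fun w => (starRingEnd ℂ) ((starRingEnd ℂ) w ^ 2 * F₀ w -
      2 * (starRingEnd ℂ) w * F₁ w + F₂ w) := by
    filter_upwards [Metric.isOpen_ball.mem_nhds hzb] with w hw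
    rw [hξ, mul_integral_segment_eq_sub (convex_ball c r) hI hw
      (g := fun ζ => ((starRingEnd ℂ) w - ζ) ^ 2 * f ζ)
      (G := fun ζ => (starRingEnd ℂ) w ^ 2 * F₀ ζ - 2 * (starRingEnd ℂ) w * F₁ ζ + F₂ ζ)
      (fun ζ hζ => ?_) (ContinuousOn.mul (by fun_prop) hf'.continuousOn)]
    · simp [hF₀I, hF₁I, hF₂I]
    · refine ((((hF₀ ζ hζ).const_mul _).sub ((hF₁ ζ hζ).const_mul _)).add
        (hF₂ ζ hζ)).congr_deriv ?_
      simp only [Pi.mul_apply, Pi.pow_apply, id]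
      ring
  have hbar : wirtingerDbar ξ z = wirtingerDbar (fun w => (starRingEnd ℂ)
      ((starRingEnd ℂ) w ^ 2 * F₀ w - 2 * (starRingEnd ℂ) w * F₁ w + F₂ w)) z := by
    simp only [wirtingerDbar, hev.fderiv_eq]
  rw [hbar, wirtingerDbar_conj_quadratic (hF₀ z hzb) (hF₁ z hzb) (hF₂ z hzb)]
  simp [Complex.conj_ofNat]
  ring
end

section
/- For an integer n ≥ 0 define ξ : ℍ → ℂ by ξ(z) = ∫₀^{Im z} (−i)·ζ²·(z − 2iζ)ⁿ dζ (the integral over the real variable ζ from 0 to Im z). Then for every z ∈ ℍ, ∂ξ/∂z̄(z) = ((Im z)²/2)·conj(zⁿ); that is, ξ is an explicit harmonic vector field on ℍ whose associated holomorphic quadratic differential is q = zⁿ dz². -/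
open Complex in
/-- `∂/∂z̄` is linear over holomorphic factors. -/
theorem wirtingerDbar_mul_of_holomorphic {g h : ℂ → ℂ} {z : ℂ}
    (hg : DifferentiableAt ℂ g z) (hh : DifferentiableAt ℝ h z) :
    wirtingerDbar (fun w => g w * h w) z = g z * wirtingerDbar h z := by
  have hg' := hg.hasDerivAt.hasFDerivAt.restrictScalars ℝ
  have hmul := hg'.mul hh.hasFDerivAt
  simp only [wirtingerDbar]
  rw [HasFDerivAt.fderiv (f := fun w => g w * h w) hmul]
  simp
  linear_combination (h z * deriv g z / 2) * I_mul_I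

theorem wirtingerDbar_sum {ι : Type*} (s : Finset ι) {f : ι → ℂ → ℂ} {z : ℂ}
    (hf : ∀ i ∈ s, DifferentiableAt ℝ (f i) z) :
    wirtingerDbar (fun w => ∑ i ∈ s, f i w) z = ∑ i ∈ s, wirtingerDbar (f i) z := by
  simp only [wirtingerDbar]
  rw [fderiv_fun_sum hf]
  simp [mul_add, Finset.mul_sum, Finset.sum_add_distrib]

theorem hasFDerivAt_im_pow_succ_div (m : ℕ) (z : ℂ) :
    HasFDerivAt (fun w : ℂ => (w.im : ℂ) ^ (m + 1) / ((m : ℂ) + 1))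
      ((z.im : ℂ) ^ m • (Complex.ofRealCLM.comp Complex.imCLM)) z := by
  have hm : (m : ℂ) + 1 ≠ 0 := Nat.cast_add_one_ne_zero m
  have him : HasFDerivAt (fun w : ℂ => (w.im : ℂ)) (Complex.ofRealCLM.comp Complex.imCLM) z :=
    (Complex.ofRealCLM.comp Complex.imCLM).hasFDerivAt
  have h := (him.pow (m + 1)).mul_const ((m : ℂ) + 1)⁻¹
  simp only [div_eq_mul_inv]
  refine h.congr_fderiv (ContinuousLinearMap.ext fun v => ?_)
  simp
  field_simp

theorem wirtingerDbar_im_pow_succ_div (m : ℕ) (z : ℂ) :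
    wirtingerDbar (fun w : ℂ => (w.im : ℂ) ^ (m + 1) / ((m : ℂ) + 1)) z =
      Complex.I / 2 * (z.im : ℂ) ^ m := by
  simp only [wirtingerDbar]
  rw [(hasFDerivAt_im_pow_succ_div m z).fderiv]
  simp
  ring

open Complex in
theorem integral_eq_sum_im_pow (n : ℕ) (z : ℂ) :
    ∫ ζ in (0:ℝ)..z.im, (-I) * (ζ : ℂ) ^ 2 * (z - 2 * I * (ζ : ℂ)) ^ n =
      ∑ k ∈ Finset.range (n + 1), (-I * (-2 * I) ^ (n - k) * n.choose k * z ^ k) *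
        ((z.im : ℂ) ^ (n - k + 2 + 1) / (((n - k + 2 : ℕ) : ℂ) + 1)) := by
  have hexpand (ζ : ℝ) : (-I) * (ζ : ℂ) ^ 2 * (z - 2 * I * (ζ : ℂ)) ^ n =
      ∑ k ∈ Finset.range (n + 1), (-I * (-2 * I) ^ (n - k) * n.choose k * z ^ k) *
        ((ζ ^ (n - k + 2) : ℝ) : ℂ) := by
    rw [sub_eq_add_neg, add_pow, Finset.mul_sum]
    refine Finset.sum_congr rfl fun k _ => ?_
    rw [← neg_mul, ← neg_mul, mul_pow (-2 * I)]
    push_cast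
    ring
  simp only [hexpand]
  rw [intervalIntegral.integral_finsetSum fun k _ =>
    Continuous.intervalIntegrable (by fun_prop) _ _]
  refine Finset.sum_congr rfl fun k _ => ?_
  rw [intervalIntegral.integral_const_mul, intervalIntegral.integral_ofReal, integral_pow]
  push_cast
  simp

/-- The explicit vector field `ξ(z) = ∫₀^{Im z} (−i)ζ²(z − 2iζ)ⁿ dζ` is a harmonic
vector field on the upper half-plane whose associated holomorphic quadratic
differential is `q = zⁿ dz²`. -/
theorem statement5 (n : ℕ)
    (ξ : ℂ → ℂ)
    (hξ : ∀ z : ℂ, ξ z = ∫ ζ in (0:ℝ)..z.im,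
        (-Complex.I) * (ζ : ℂ) ^ 2 * (z - 2 * Complex.I * (ζ : ℂ)) ^ n) :
    ∀ z : ℂ, 0 < z.im →
      wirtingerDbar ξ z = ((z.im ^ 2 / 2 : ℝ) : ℂ) * (starRingEnd ℂ) (z ^ n) := by
  intro z _
  have hconj : (starRingEnd ℂ) z = z + -2 * Complex.I * (z.im : ℂ) := by
    apply Complex.ext <;> simp
    ring
  have hpow (m : ℕ) := (hasFDerivAt_im_pow_succ_div m z).differentiableAt
  have hhol (c : ℂ) (k : ℕ) : DifferentiableAt ℂ (fun w : ℂ => c * w ^ k) z := by fun_prop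
  rw [funext fun w => (hξ w).trans (integral_eq_sum_im_pow n w), wirtingerDbar_sum _ fun k _ =>
    ((hhol _ k).restrictScalars ℝ).fun_mul (hpow _), map_pow, hconj, add_pow, Finset.mul_sum]
  refine Finset.sum_congr rfl fun k _ => ?_
  rw [wirtingerDbar_mul_of_holomorphic (hhol _ k) (hpow _), wirtingerDbar_im_pow_succ_div,
    mul_pow (-2 * Complex.I), pow_add]
  push_cast
  linear_combination (-(-2 * Complex.I) ^ (n - k) * n.choose k * z ^ k * (z.im : ℂ) ^ (n - k) *
    (z.im : ℂ) ^ 2 / 2) * Complex.I_mul_I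
end

section
/- (Splitting of cocycles with values in smooth vector fields.) Let Γ be a subgroup of SL(2,ℝ) with −1 ∉ Γ acting on ℍ by Möbius transformations, and let φ : ℍ → ℝ be a smooth function satisfying: (1) 0 ≤ φ ≤ 1; (2) every z ∈ ℍ has an open neighborhood U and a finite S ⊆ Γ with φ(γ•w) = 0 for all γ ∈ Γ∖S and w ∈ U; (3) Σ_{γ∈Γ} φ(γ•z) = 1 for every z ∈ ℍ. Let (c_γ)_{γ∈Γ} be a family of smooth functions ℍ → ℂ satisfying the cocycle condition c_{γ₁·γ₂}(z) = c_{γ₁}(γ₂•z)·j(γ₂, z)² + c_{γ₂}(z) for all γ₁, γ₂ ∈ Γ and z ∈ ℍ, where j(γ, z) = γ₀z + δ is the automorphy factor (so the complex derivative of the Möbius map of γ at z is j(γ, z)^{−2}). Define ψ(z) = −Σ_{γ∈Γ} φ(γ•z)·c_γ(z) (for each z a sum with only finitely many nonzero terms). Then ψ is a smooth function on ℍ, and for every A ∈ Γ and every z ∈ ℍ, ψ(A•z)·j(A, z)² − ψ(z) = c_A(z); i.e. the coboundary of ψ equals the cocycle c. -/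
/-- The Möbius action of an element of `SL(2,ℝ)` on ℂ (meaningful on the upper
half-plane): `γ • z = (αz + β)/(γ₀z + δ)`. -/
noncomputable def moebiusSL (γ : Matrix.SpecialLinearGroup (Fin 2) ℝ) (z : ℂ) : ℂ :=
  ((γ.1 0 0 : ℂ) * z + (γ.1 0 1 : ℂ)) / ((γ.1 1 0 : ℂ) * z + (γ.1 1 1 : ℂ))

/-- The automorphy factor `j(γ, z) = γ₀ z + δ`; the complex derivative of the
Möbius map of `γ` at `z` is `j(γ, z)⁻²`. -/
noncomputable def jFactor (γ : Matrix.SpecialLinearGroup (Fin 2) ℝ) (z : ℂ) : ℂ :=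
  (γ.1 1 0 : ℂ) * z + (γ.1 1 1 : ℂ)

namespace moebiusSL

theorem jFactor_ne_zero (γ : Matrix.SpecialLinearGroup (Fin 2) ℝ) {z : ℂ} (hz : 0 < z.im) :
    jFactor γ z ≠ 0 := by
  intro h
  have him : γ.1 1 0 = 0 := by simpa [jFactor, hz.ne'] using congrArg Complex.im h
  have hre : γ.1 1 1 = 0 := by simpa [jFactor, him] using congrArg Complex.re h
  have hdet := γ.2
  rw [Matrix.det_fin_two, him, hre] at hdet
  simp at hdet

theorem eq_coe_smul (γ : Matrix.SpecialLinearGroup (Fin 2) ℝ) (z : UpperHalfPlane) :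
    moebiusSL γ z = ↑(γ • z) := by
  simp [moebiusSL, UpperHalfPlane.coe_specialLinearGroup_apply]

theorem im_pos (γ : Matrix.SpecialLinearGroup (Fin 2) ℝ) {z : ℂ} (hz : 0 < z.im) :
    0 < (moebiusSL γ z).im := by
  rw [eq_coe_smul γ ⟨z, hz⟩]
  exact (γ • (⟨z, hz⟩ : UpperHalfPlane)).im_pos

theorem mul_apply (γ A : Matrix.SpecialLinearGroup (Fin 2) ℝ) {z : ℂ} (hz : 0 < z.im) :
    moebiusSL (γ * A) z = moebiusSL γ (moebiusSL A z) := by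
  rw [eq_coe_smul _ ⟨z, hz⟩, eq_coe_smul A ⟨z, hz⟩, eq_coe_smul, mul_smul]

theorem contDiffOn (γ : Matrix.SpecialLinearGroup (Fin 2) ℝ) {n : WithTop ℕ∞} :
    ContDiffOn ℝ n (moebiusSL γ) {z : ℂ | 0 < z.im} := by
  have hnum : ContDiff ℝ n fun z : ℂ => (γ.1 0 0 : ℂ) * z + (γ.1 0 1 : ℂ) := by fun_prop
  have hden : ContDiff ℝ n (jFactor γ) := by unfold jFactor; fun_prop
  exact hnum.contDiffOn.mul (hden.contDiffOn.inv fun z hz => jFactor_ne_zero γ hz)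

end moebiusSL

/-- Splitting of cocycles with values in smooth vector fields: given a
`Γ`-invariant partition of unity `φ` and a smooth `1`-cocycle `(c_γ)`, the
function `ψ(z) = −Σ_{γ∈Γ} φ(γ•z)·c_γ(z)` is smooth on ℍ and its coboundary is
`c`: `ψ(A•z)·j(A,z)² − ψ(z) = c_A(z)` for all `A ∈ Γ`, `z ∈ ℍ`. -/
theorem statement13 (Γ : Subgroup (Matrix.SpecialLinearGroup (Fin 2) ℝ))
    (hneg : (-1 : Matrix.SpecialLinearGroup (Fin 2) ℝ) ∉ Γ)
    (φ : ℂ → ℝ)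
    (hφsmooth : ContDiffOn ℝ ((⊤ : ℕ∞) : WithTop ℕ∞) φ {z : ℂ | 0 < z.im})
    (hφ01 : ∀ z : ℂ, 0 < z.im → 0 ≤ φ z ∧ φ z ≤ 1)
    (hφloc : ∀ z : ℂ, 0 < z.im → ∃ U : Set ℂ, IsOpen U ∧ z ∈ U ∧
      U ⊆ {z : ℂ | 0 < z.im} ∧
      ∃ S : Set Γ, S.Finite ∧
        ∀ γ : Γ, γ ∉ S → ∀ w ∈ U, φ (moebiusSL ↑γ w) = 0)
    (hφsum : ∀ z : ℂ, 0 < z.im → ∑ᶠ γ : Γ, φ (moebiusSL ↑γ z) = 1)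
    (c : Γ → ℂ → ℂ)
    (hcsmooth : ∀ γ : Γ, ContDiffOn ℝ ((⊤ : ℕ∞) : WithTop ℕ∞) (c γ) {z : ℂ | 0 < z.im})
    (hcocycle : ∀ γ₁ γ₂ : Γ, ∀ z : ℂ, 0 < z.im →
      c (γ₁ * γ₂) z = c γ₁ (moebiusSL ↑γ₂ z) * (jFactor ↑γ₂ z) ^ 2 + c γ₂ z)
    (ψ : ℂ → ℂ)
    (hψ : ∀ z : ℂ, 0 < z.im →
      ψ z = -∑ᶠ γ : Γ, (φ (moebiusSL ↑γ z) : ℂ) * c γ z) :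
    ContDiffOn ℝ ((⊤ : ℕ∞) : WithTop ℕ∞) ψ {z : ℂ | 0 < z.im} ∧
      ∀ A : Γ, ∀ z : ℂ, 0 < z.im →
        ψ (moebiusSL ↑A z) * (jFactor ↑A z) ^ 2 - ψ z = c A z := by
  have hterm : ∀ γ : Γ, ContDiffOn ℝ ((⊤ : ℕ∞) : WithTop ℕ∞)
      (fun z => (φ (moebiusSL ↑γ z) : ℂ) * c γ z) {z : ℂ | 0 < z.im} := fun γ =>
    (Complex.ofRealCLM.contDiff.comp_contDiffOn
      (hφsmooth.comp (moebiusSL.contDiffOn ↑γ) fun _ hz => moebiusSL.im_pos ↑γ hz)).mul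
      (hcsmooth γ)
  have hfin : ∀ z : ℂ, 0 < z.im →
      (Function.support fun γ : Γ => φ (moebiusSL ↑γ z)).Finite := by
    intro z hz
    obtain ⟨U, -, hzU, -, S, hS, hzero⟩ := hφloc z hz
    exact hS.subset fun γ hγ => by_contra fun hγS => hγ (hzero γ hγS z hzU)
  refine ⟨fun z hz => ?_, fun A z hz => ?_⟩
  · obtain ⟨U, hUo, hzU, hU, S, hS, hzero⟩ := hφloc z hz
    have hEq : ∀ w ∈ U, ψ w = -∑ γ ∈ hS.toFinset, (φ (moebiusSL ↑γ w) : ℂ) * c γ w := by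
      intro w hw
      rw [hψ w (hU hw), finsum_eq_sum_of_support_subset]
      intro γ hγ
      by_contra hγS
      exact hγ (by simp [hzero γ (by simpa using hγS) w hw])
    have hsum : ContDiffOn ℝ ((⊤ : ℕ∞) : WithTop ℕ∞)
        (fun w => -∑ γ ∈ hS.toFinset, (φ (moebiusSL ↑γ w) : ℂ) * c γ w) {z : ℂ | 0 < z.im} :=
      (ContDiffOn.sum fun γ _ => hterm γ).neg
    exact (hsum z hz).congr_of_eventuallyEq
      (Filter.mem_of_superset (mem_nhdsWithin_of_mem_nhds (hUo.mem_nhds hzU)) hEq) (hEq z hzU)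
  · have hfinC : (Function.support fun γ : Γ => (φ (moebiusSL ↑γ z) : ℂ)).Finite := by
      simpa [Function.support] using hfin z hz
    have hsumC : ∑ᶠ γ : Γ, (φ (moebiusSL ↑γ z) : ℂ) = 1 := by
      have h := Complex.ofRealHom.toAddMonoidHom.map_finsum (hfin z hz)
      rw [hφsum z hz] at h
      simpa using h.symm
    have hshift : (∑ᶠ γ : Γ, (φ (moebiusSL ↑γ (moebiusSL ↑A z)) : ℂ) * c γ (moebiusSL ↑A z)) *
        jFactor ↑A z ^ 2 = ∑ᶠ γ : Γ, (φ (moebiusSL ↑γ z) : ℂ) * (c γ z - c A z) := by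
      rw [finsum_mul', ← finsum_comp_equiv (Equiv.mulRight A)
        (f := fun γ : Γ => (φ (moebiusSL ↑γ z) : ℂ) * (c γ z - c A z))]
      · refine finsum_congr fun γ => ?_
        rw [Equiv.coe_mulRight, hcocycle γ A z hz, Subgroup.coe_mul, moebiusSL.mul_apply _ _ hz]
        ring
      · refine (hfin _ (moebiusSL.im_pos ↑A hz)).subset fun γ hγ h0 => hγ ?_
        simp only at h0
        simp [h0]
    have hsplit : ∑ᶠ γ : Γ, (φ (moebiusSL ↑γ z) : ℂ) * (c γ z - c A z) =
        (∑ᶠ γ : Γ, (φ (moebiusSL ↑γ z) : ℂ) * c γ z) - c A z := by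
      simp_rw [mul_sub]
      rw [finsum_sub_distrib, ← finsum_mul' _ _ hfinC, hsumC, one_mul]
      · exact hfinC.subset (Function.support_mul_subset_left _ _)
      · exact hfinC.subset (Function.support_mul_subset_left _ _)
    rw [hψ _ (moebiusSL.im_pos ↑A hz), hψ z hz, neg_mul, hshift, hsplit]
    ring
end

section
/- (The Poisson kernel vector field is harmonic.) Let K : 𝔻 → ℂ be the Poisson kernel vector field K(z) = i·(1 − |z|²)³ / ((1 − z)·(1 − conj(z))³). Then K is a harmonic vector field on the open unit disk: the function z ↦ conj( (8/(1 − |z|²)²)·(∂K/∂z̄)(z) ) is holomorphic on 𝔻. -/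
open Complex ComplexConjugate in
/-- A real-differentiable function whose differential is `v ↦ a v + b v̄` has Wirtinger
derivative `∂f/∂z̄ = b`. -/
theorem wirtingerDbar_eq_of_hasFDerivAt {f : ℂ → ℂ} {z a b : ℂ} {L : ℂ →L[ℝ] ℂ}
    (hf : HasFDerivAt f L z) (hL : ∀ v, L v = a * v + b * conj v) :
    wirtingerDbar f z = b := by
  simp only [wirtingerDbar, hf.fderiv, hL, map_one, conj_I]
  linear_combination (a - b) / 2 * I_sq

open Complex ComplexConjugate in
theorem wirtingerDbar_poissonKernel {z : ℂ} (hz : z ≠ 1) :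
    wirtingerDbar (fun z => I * (1 - z * conj z) ^ 3 / ((1 - z) * (1 - conj z) ^ 3)) z =
      3 * I * (1 - z * conj z) ^ 2 / (1 - conj z) ^ 4 := by
  have hz₁ : 1 - z ≠ 0 := sub_ne_zero.2 hz.symm
  have hz₂ : 1 - conj z ≠ 0 := by
    simpa using (map_ne_zero (starRingEnd ℂ)).2 hz₁
  have hid : HasFDerivAt (fun w : ℂ => w) (ContinuousLinearMap.id ℝ ℂ) z := hasFDerivAt_id z
  have hconj : HasFDerivAt (fun w : ℂ => conj w) (conjCLE : ℂ →L[ℝ] ℂ) z :=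
    conjCLE.hasFDerivAt
  have hnum := (((hid.fun_mul hconj).const_sub 1).pow 3).const_mul I
  have hden := (hid.const_sub 1).fun_mul ((hconj.const_sub 1).pow 3)
  refine wirtingerDbar_eq_of_hasFDerivAt
    (a := I * (1 - z * conj z) ^ 2 * (1 - 3 * conj z + 2 * z * conj z) /
      ((1 - z) ^ 2 * (1 - conj z) ^ 3))
    (hnum.fun_mul
      ((hasFDerivAt_inv' (mul_ne_zero hz₁ (pow_ne_zero 3 hz₂))).comp z hden)) fun v => ?_
  simp
  field_simp
  ring

/-- The Poisson kernel vector field `K(z) = i(1 − |z|²)³/((1 − z)(1 − z̄)³)` is a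
harmonic vector field on the open unit disk: the associated quadratic
differential coefficient `z ↦ conj((8/(1 − |z|²)²)·∂K/∂z̄(z))` is holomorphic. -/
theorem statement15 (K : ℂ → ℂ)
    (hK : ∀ z, K z = Complex.I * ((1 - Complex.normSq z : ℝ) : ℂ) ^ 3 /
        ((1 - z) * (1 - (starRingEnd ℂ) z) ^ 3)) :
    DifferentiableOn ℂ
      (fun z => (starRingEnd ℂ)
        ((8 / ((1 - Complex.normSq z : ℝ) : ℂ) ^ 2) * wirtingerDbar K z))
      (Metric.ball 0 1) := by
  obtain rfl : K = fun z => Complex.I * (1 - z * (starRingEnd ℂ) z) ^ 3 /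
      ((1 - z) * (1 - (starRingEnd ℂ) z) ^ 3) := by
    funext z
    simp [hK, Complex.mul_conj]
  have hne : ∀ z ∈ Metric.ball (0 : ℂ) 1, z ≠ 1 := by
    rintro _ hz rfl
    simp at hz
  have hdiff : DifferentiableOn ℂ (fun z : ℂ => -24 * Complex.I / (1 - z) ^ 4)
      (Metric.ball 0 1) := fun z hz =>
    DifferentiableAt.differentiableWithinAt <| by
      have := sub_ne_zero.2 (hne z hz).symm
      fun_prop (disch := positivity)
  refine hdiff.congr fun z hz => ?_
  have hz₁ : 1 - z ≠ 0 := sub_ne_zero.2 (hne z hz).symm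
  have hnorm : 1 - z * (starRingEnd ℂ) z ≠ 0 := by
    rw [Complex.mul_conj, Complex.normSq_eq_norm_sq]
    norm_cast
    have : ‖z‖ < 1 := by simpa using hz
    nlinarith [norm_nonneg z]
  have hnorm' : 1 - (starRingEnd ℂ) z * z ≠ 0 := by rwa [mul_comm]
  rw [wirtingerDbar_poissonKernel (hne z hz), Complex.ofReal_sub, ← Complex.mul_conj]
  simp only [map_mul, map_div₀, map_pow, map_sub, map_one, map_ofNat, Complex.conj_conj,
    Complex.conj_I, Complex.ofReal_one]
  field_simp
  ring
end

section
/- (All nonidentity elements of a cocompact torsion-free Fuchsian group are hyperbolic.) Let Γ be a subgroup of SL(2,ℝ) with −1 ∉ Γ, acting on the upper half-plane ℍ by Möbius transformations, such that the action is free (γ•z ≠ z for all γ ∈ Γ∖{1} and z ∈ ℍ), properly discontinuous, and cocompact. Then every element γ ∈ Γ with γ ≠ 1 is hyperbolic, i.e. (trace γ)² > 4. -/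
open UpperHalfPlane

open scoped MatrixGroups

/-- The displacement of a point of the upper half-plane under a Möbius transformation. -/
theorem cosh_dist_smul (g : SL(2, ℝ)) (z : ℍ) :
    Real.cosh (dist z (g • z)) =
      1 + Complex.normSq (g 1 0 * (z : ℂ) ^ 2 + (g 1 1 - g 0 0) * z - g 0 1) /
        (2 * z.im ^ 2) := by
  have hden : (g 1 0 : ℂ) * z + g 1 1 ≠ 0 := denom_ne_zero g z
  have hsq : Complex.normSq ((g 1 0 : ℂ) * z + g 1 1) ≠ 0 := by simpa using hden
  have him : (g • z).im = z.im / Complex.normSq ((g 1 0 : ℂ) * z + g 1 1) := by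
    rw [MulAction.compHom_smul_def, UpperHalfPlane.im_smul_eq_div_normSq]
    simp [denom]
  have hcoe : ((g • z : ℍ) : ℂ) = (g 0 0 * z + g 0 1) / (g 1 0 * z + g 1 1) := by
    simpa using coe_specialLinearGroup_apply g z
  have hsub : (z : ℂ) - (g • z : ℍ) =
      (g 1 0 * (z : ℂ) ^ 2 + (g 1 1 - g 0 0) * z - g 0 1) / (g 1 0 * z + g 1 1) := by
    rw [hcoe, eq_div_iff hden, sub_mul, div_mul_cancel₀ _ hden]
    ring
  rw [cosh_dist, dist_eq_norm, ← Complex.normSq_eq_norm_sq, hsub, him, Complex.normSq_div]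
  have := z.im_ne_zero
  field_simp

/-- A non-hyperbolic Möbius transformation moves some points arbitrarily little. -/
theorem exists_dist_smul_lt {g : SL(2, ℝ)} (hg : (g : Matrix (Fin 2) (Fin 2) ℝ).trace ^ 2 ≤ 4)
    {ε : ℝ} (hε : 0 < ε) : ∃ z : ℍ, dist z (g • z) < ε := by
  suffices h : ∀ η > 0, ∃ z : ℍ,
      Complex.normSq (g 1 0 * (z : ℂ) ^ 2 + (g 1 1 - g 0 0) * z - g 0 1) ≤ η * z.im ^ 2 by
    have hcosh : 1 < Real.cosh ε := Real.one_lt_cosh.2 hε.ne'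
    obtain ⟨z, hz⟩ := h (Real.cosh ε - 1) (by linarith)
    refine ⟨z, ?_⟩
    rw [← abs_of_nonneg (dist_nonneg (x := z) (y := g • z)), ← abs_of_pos hε,
      ← Real.cosh_lt_cosh, cosh_dist_smul]
    have hpos : 0 < z.im ^ 2 := pow_pos z.im_pos 2
    have : Complex.normSq (g 1 0 * (z : ℂ) ^ 2 + (g 1 1 - g 0 0) * z - g 0 1) /
        (2 * z.im ^ 2) ≤ (Real.cosh ε - 1) / 2 := by
      rw [div_le_iff₀ (by positivity)]
      linarith
    linarith
  intro η hη
  have hdet : g 0 0 * g 1 1 - g 0 1 * g 1 0 = 1 := by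
    rw [← Matrix.det_fin_two, g.det_coe]
  rw [Matrix.trace_fin_two] at hg
  generalize g 0 0 = a at *
  generalize g 0 1 = b at *
  generalize g 1 0 = c at *
  generalize g 1 1 = d at *
  by_cases hc : c = 0
  · subst hc
    have hda : d = a := by nlinarith [sq_nonneg (a - d)]
    subst hda
    have hy : 0 < √(b ^ 2 / η) + 1 := by positivity
    refine ⟨⟨⟨0, √(b ^ 2 / η) + 1⟩, hy⟩, ?_⟩
    have hs : √(b ^ 2 / η) ^ 2 = b ^ 2 / η := Real.sq_sqrt (by positivity)
    have hb : η * (b ^ 2 / η) = b ^ 2 := by field_simp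
    have : b ^ 2 ≤ η * (√(b ^ 2 / η) + 1) ^ 2 := by
      nlinarith [Real.sqrt_nonneg (b ^ 2 / η)]
    simpa [Complex.normSq_apply, ← sq] using this
  · have hs : 0 ≤ (4 - (a + d) ^ 2) / (4 * c ^ 2) := div_nonneg (by linarith) (by positivity)
    set s := (4 - (a + d) ^ 2) / (4 * c ^ 2) with hsdef
    set t := η / c ^ 2 with htdef
    have ht : 0 < t := by positivity
    have hy : 0 < √(s + t) := Real.sqrt_pos.2 (by linarith)
    have hsq : √(s + t) ^ 2 = s + t := Real.sq_sqrt (by linarith)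
    refine ⟨⟨⟨(a - d) / (2 * c), √(s + t)⟩, hy⟩, ?_⟩
    have hval : (c : ℂ) * (⟨(a - d) / (2 * c), √(s + t)⟩ : ℂ) ^ 2 +
        (d - a) * (⟨(a - d) / (2 * c), √(s + t)⟩ : ℂ) - b = ((-(c * t) : ℝ) : ℂ) := by
      apply Complex.ext
      · have : c * (((a - d) / (2 * c)) ^ 2 - √(s + t) ^ 2) +
            (d - a) * ((a - d) / (2 * c)) - b = -(c * t) := by
          rw [hsq, hsdef]
          field_simp
          linear_combination 16 * hdet
        simpa [sq] using this
      · have : c * (2 * ((a - d) / (2 * c)) * √(s + t)) + (d - a) * √(s + t) = 0 := by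
          field_simp
          ring
        simp [sq]
        linear_combination this
    change Complex.normSq ((c : ℂ) * (⟨(a - d) / (2 * c), √(s + t)⟩ : ℂ) ^ 2 +
        (d - a) * (⟨(a - d) / (2 * c), √(s + t)⟩ : ℂ) - b) ≤ η * √(s + t) ^ 2
    have hη' : η = c ^ 2 * t := by rw [htdef]; field_simp
    rw [hval, Complex.normSq_ofReal, hsq, hη']
    have : 0 ≤ c ^ 2 * t * s := by positivity
    nlinarith

/-- A group acting freely, properly discontinuously and cocompactly by isometries on a proper
metric space moves every point by at least some uniform positive distance. -/
theorem exists_pos_le_dist_smul {G X : Type*} [Group G] [MetricSpace X] [ProperSpace X]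
    [MulAction G X] [IsIsometricSMul G X] (Γ : Subgroup G)
    (hfree : ∀ γ ∈ Γ, γ ≠ 1 → ∀ x : X, γ • x ≠ x)
    (hpd : ∀ K : Set X, IsCompact K →
      {γ : G | γ ∈ Γ ∧ ((fun x => γ • x) '' K ∩ K).Nonempty}.Finite)
    (hcc : ∃ K : Set X, IsCompact K ∧ (⋃ γ ∈ Γ, (fun x => γ • x) '' K) = Set.univ) :
    ∃ δ > 0, ∀ γ ∈ Γ, γ ≠ 1 → ∀ x : X, δ ≤ dist x (γ • x) := by
  obtain ⟨K, hK, hcover⟩ := hcc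
  have hfin := hpd _ (hK.cthickening (r := 1))
  have hmin : ∀ γ ∈ Γ, γ ≠ 1 → ∃ δ > 0, ∀ x ∈ K, δ ≤ dist x (γ • x) := by
    intro γ hγ hne
    rcases K.eq_empty_or_nonempty with rfl | hKne
    · exact ⟨1, one_pos, by simp⟩
    · obtain ⟨x, -, hx⟩ := hK.exists_isMinOn hKne
        (f := fun x => dist x (γ • x)) (by fun_prop)
      exact ⟨dist x (γ • x), dist_pos.2 (hfree γ hγ hne x).symm, fun y hy => hx hy⟩
  choose! f hfpos hf using hmin
  obtain ⟨δ, hδ, hδf⟩ : ∃ δ > 0, ∀ γ ∈ Γ, γ ≠ 1 → ∀ x ∈ K, δ ≤ dist x (γ • x) := by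
    have hfin' := hfin.subset (t := {γ | (γ ∈ Γ ∧ γ ≠ 1) ∧
      ((fun x => γ • x) '' Metric.cthickening 1 K ∩ Metric.cthickening 1 K).Nonempty})
      fun γ h => ⟨h.1.1, h.2⟩
    obtain ⟨δ, hδ, hle⟩ : ∃ δ > 0, ∀ γ ∈ hfin'.toFinset, δ ≤ f γ := by
      rcases hfin'.toFinset.eq_empty_or_nonempty with he | hne
      · exact ⟨1, one_pos, by rw [he]; simp⟩
      · obtain ⟨γ, hγ, hmin⟩ := hfin'.toFinset.exists_min_image f hne
        have hγ' := hfin'.mem_toFinset.1 hγ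
        exact ⟨f γ, hfpos γ hγ'.1.1 hγ'.1.2, hmin⟩
    refine ⟨min δ 1, by positivity, fun γ hγ hne x hx => ?_⟩
    by_cases hd : dist x (γ • x) ≤ 1
    · refine (min_le_left _ _).trans ((hle γ (hfin'.mem_toFinset.2 ⟨⟨hγ, hne⟩, γ • x,
        ⟨x, Metric.self_subset_cthickening K hx, rfl⟩, ?_⟩)).trans (hf γ hγ hne x hx))
      exact Metric.mem_cthickening_of_dist_le _ x _ _ hx (by rwa [dist_comm])
    · exact (min_le_right _ _).trans (not_le.1 hd).le
  refine ⟨δ, hδ, fun γ hγ hne x => ?_⟩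
  have hx : x ∈ ⋃ g ∈ Γ, (fun x => g • x) '' K := hcover ▸ Set.mem_univ x
  simp only [Set.mem_iUnion] at hx
  obtain ⟨g, hg, k, hk, rfl⟩ := hx
  have hconj := hδf (g⁻¹ * γ * g) (Γ.mul_mem (Γ.mul_mem (Γ.inv_mem hg) hγ) hg)
    (fun h => hne (by simpa [mul_assoc, inv_mul_eq_one, eq_comm] using h)) k hk
  rwa [← dist_smul g, smul_smul, ← mul_assoc, ← mul_assoc, mul_inv_cancel, one_mul,
    ← smul_smul] at hconj

/-- All nonidentity elements of a cocompact torsion-free Fuchsian group are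
hyperbolic: if `Γ ≤ SL(2,ℝ)` with `−1 ∉ Γ` acts freely, properly discontinuously
and cocompactly on the upper half-plane, then every `γ ∈ Γ`, `γ ≠ 1`, satisfies
`(trace γ)² > 4`. -/
theorem statement18 (Γ : Subgroup (Matrix.SpecialLinearGroup (Fin 2) ℝ))
    (hneg : (-1 : Matrix.SpecialLinearGroup (Fin 2) ℝ) ∉ Γ)
    (hfree : ∀ γ ∈ Γ, γ ≠ 1 → ∀ z : UpperHalfPlane, γ • z ≠ z)
    (hpd : ∀ K : Set UpperHalfPlane, IsCompact K →
      {γ : Matrix.SpecialLinearGroup (Fin 2) ℝ |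
        γ ∈ Γ ∧ ((fun z => γ • z) '' K ∩ K).Nonempty}.Finite)
    (hcc : ∃ K : Set UpperHalfPlane, IsCompact K ∧
      (⋃ γ ∈ Γ, (fun z => γ • z) '' K) = Set.univ) :
    ∀ γ ∈ Γ, γ ≠ 1 →
      (Matrix.trace ((γ : Matrix.SpecialLinearGroup (Fin 2) ℝ) :
        Matrix (Fin 2) (Fin 2) ℝ)) ^ 2 > 4 := by
  obtain ⟨δ, hδ, hle⟩ := exists_pos_le_dist_smul Γ hfree hpd hcc
  intro γ hγ hne
  by_contra! htr
  obtain ⟨z, hz⟩ := exists_dist_smul_lt htr hδ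
  exact (hle γ hγ hne z).not_gt hz
end

section
/- (Surjectivity of the differential of the commutator map at a pair of noncommuting hyperbolic elements.) Let A, B ∈ SL(2,ℝ) be hyperbolic, i.e. (trace A)² > 4 and (trace B)² > 4, and suppose A·B ≠ B·A. Then the ℝ-linear map from pairs of traceless real 2×2 matrices to traceless real 2×2 matrices given by (u, v) ↦ (B⁻¹·u·B − u) + (v − A⁻¹·v·A) is surjective: for every real 2×2 matrix w with trace w = 0 there exist real 2×2 matrices u, v with trace u = trace v = 0 such that (B⁻¹·u·B − u) + (v − A⁻¹·v·A) = w. -/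
open Matrix

/-- A traceless matrix orthogonal to `M` for the trace form intertwines `M` and its adjugate. -/
lemma adjugate_mul_eq_mul_of_trace_eq_zero (M w : Matrix (Fin 2) (Fin 2) ℝ) (hw : trace w = 0)
    (hwM : trace (w * M) = 0) : adjugate M * w = w * M := by
  rw [adjugate_fin_two]
  simp only [trace_fin_two, mul_apply, Fin.sum_univ_two] at hw hwM
  ext i j
  fin_cases i <;> fin_cases j <;> simp [mul_apply, Fin.sum_univ_two]
  · linear_combination M 1 1 * hw - hwM
  · linear_combination -M 0 1 * hw
  · linear_combination -M 1 0 * hw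
  · linear_combination M 0 0 * hw - hwM

lemma mul_self_add_adjugate_mul_self (M : Matrix (Fin 2) (Fin 2) ℝ) :
    M * M + adjugate M * adjugate M
      = (trace M ^ 2 - 2 * det M) • (1 : Matrix (Fin 2) (Fin 2) ℝ) := by
  rw [adjugate_fin_two, det_fin_two, trace_fin_two]
  ext i j
  fin_cases i <;> fin_cases j <;> simp [mul_apply, Fin.sum_univ_two] <;> ring

/-- If `det M = 1` and `(tr M)² ≠ 4`, the range of `v ↦ v - M⁻¹ v M` on traceless matrices contains
every traceless matrix orthogonal to `M` for the trace form. -/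
lemma exists_sub_adjugate_conj_eq (M : Matrix (Fin 2) (Fin 2) ℝ) (hdet : det M = 1)
    (hM : trace M ^ 2 ≠ 4) (w : Matrix (Fin 2) (Fin 2) ℝ) (hw : trace w = 0)
    (hwM : trace (w * M) = 0) :
    ∃ v : Matrix (Fin 2) (Fin 2) ℝ, trace v = 0 ∧ v - adjugate M * v * M = w := by
  have hcomm := adjugate_mul_eq_mul_of_trace_eq_zero M w hw hwM
  have hsq := mul_self_add_adjugate_mul_self M
  have hinv : adjugate M * M = 1 := by rw [adjugate_mul, hdet, one_smul]
  have hinv' : M * adjugate M = 1 := by rw [mul_adjugate, hdet, one_smul]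
  rw [hdet, mul_one] at hsq
  set t := trace M
  set N := adjugate M
  have hD : t ^ 2 - 4 ≠ 0 := sub_ne_zero.mpr hM
  have hwNN : w * (N * N) = (t ^ 2 - 2) • w - w * M * M := by
    rw [eq_sub_of_add_eq' hsq, mul_sub, mul_smul_comm, mul_one, mul_assoc]
  have htr : trace (w * M * M) = 0 := by
    rw [← hcomm, mul_assoc, trace_mul_comm, mul_assoc, hinv', mul_one, hw]
  refine ⟨(t ^ 2 - 4)⁻¹ • (w * (N * N) - w), ?_, ?_⟩
  · simp [hwNN, htr, hw]
  · have hconj : N * (w * (N * N) - w) * M = w - w * M * M := by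
      calc N * (w * (N * N) - w) * M = (N * w) * N * (N * M) - (N * w) * M := by noncomm_ring
        _ = w * (M * N) - w * M * M := by rw [hcomm, hinv, mul_one, mul_assoc w M N]
        _ = w - w * M * M := by rw [hinv', mul_one]
    rw [mul_smul_comm, smul_mul_assoc, ← smul_sub, hconj, hwNN, inv_smul_eq_iff₀ hD]
    module

/-- For noncommuting `M`, `N`, the functionals `x ↦ tr (x M)` and `x ↦ tr (x N)` on traceless
matrices are independent. -/
lemma exists_trace_mul_eq_of_mul_ne (M N : Matrix (Fin 2) (Fin 2) ℝ) (hMN : M * N ≠ N * M)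
    (s : ℝ) :
    ∃ x : Matrix (Fin 2) (Fin 2) ℝ, trace x = 0 ∧ trace (x * N) = 0 ∧ trace (x * M) = s := by
  set a₁ := M 0 0 - M 1 1
  set b₁ := N 0 0 - N 1 1
  -- the cross product of the coordinate vectors of the two functionals
  set n₁ := M 1 0 * N 0 1 - M 0 1 * N 1 0
  set n₂ := M 0 1 * b₁ - a₁ * N 0 1
  set n₃ := a₁ * N 1 0 - M 1 0 * b₁
  have hn : n₁ ^ 2 + n₂ ^ 2 + n₃ ^ 2 ≠ 0 := by
    intro h
    have h₁ : n₁ = 0 := by nlinarith [sq_nonneg n₁, sq_nonneg n₂, sq_nonneg n₃]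
    have h₂ : n₂ = 0 := by nlinarith [sq_nonneg n₁, sq_nonneg n₂, sq_nonneg n₃]
    have h₃ : n₃ = 0 := by nlinarith [sq_nonneg n₁, sq_nonneg n₂, sq_nonneg n₃]
    apply hMN
    ext i j
    fin_cases i <;> fin_cases j <;> simp [mul_apply, Fin.sum_univ_two]
    · linear_combination -h₁
    · linear_combination -h₂
    · linear_combination -h₃
    · linear_combination h₁
  set k := s / (n₁ ^ 2 + n₂ ^ 2 + n₃ ^ 2)
  have hks : k * (n₁ ^ 2 + n₂ ^ 2 + n₃ ^ 2) = s := div_mul_cancel₀ s hn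
  refine ⟨!![k * (N 1 0 * n₃ - N 0 1 * n₂), k * (N 0 1 * n₁ - b₁ * n₃);
    k * (b₁ * n₂ - N 1 0 * n₁), -(k * (N 1 0 * n₃ - N 0 1 * n₂))], ?_, ?_, ?_⟩
  · simp [trace_fin_two]
  · simp only [trace_fin_two, mul_apply, Fin.sum_univ_two, of_apply, cons_val_zero, cons_val_one]
    ring
  · rw [← hks]
    simp only [trace_fin_two, mul_apply, Fin.sum_univ_two, of_apply, cons_val_zero, cons_val_one]
    ring

/-- Surjectivity of the differential of the commutator map at a pair of
noncommuting hyperbolic elements of `SL(2,ℝ)`: the map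
`(u, v) ↦ (Ad B)u − u + v − (Ad A)v` from pairs of traceless real `2×2` matrices
to traceless real `2×2` matrices is surjective. -/
theorem statement19 (A B : Matrix.SpecialLinearGroup (Fin 2) ℝ)
    (hA : (Matrix.trace ((A : Matrix (Fin 2) (Fin 2) ℝ))) ^ 2 > 4)
    (hB : (Matrix.trace ((B : Matrix (Fin 2) (Fin 2) ℝ))) ^ 2 > 4)
    (hAB : A * B ≠ B * A) :
    ∀ w : Matrix (Fin 2) (Fin 2) ℝ, Matrix.trace w = 0 →
      ∃ u v : Matrix (Fin 2) (Fin 2) ℝ, Matrix.trace u = 0 ∧ Matrix.trace v = 0 ∧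
        (((B⁻¹ : Matrix.SpecialLinearGroup (Fin 2) ℝ) : Matrix (Fin 2) (Fin 2) ℝ) * u *
            ((B : Matrix (Fin 2) (Fin 2) ℝ)) - u)
          + (v - ((A⁻¹ : Matrix.SpecialLinearGroup (Fin 2) ℝ) : Matrix (Fin 2) (Fin 2) ℝ) * v *
            ((A : Matrix (Fin 2) (Fin 2) ℝ))) = w := by
  intro w hw
  obtain ⟨x, hx, hxB, hxA⟩ := exists_trace_mul_eq_of_mul_ne A.1 B.1
    (fun h => hAB (Subtype.ext h)) (trace (w * A.1))
  obtain ⟨u, hu, hux⟩ := exists_sub_adjugate_conj_eq B.1 B.2 hB.ne' x hx hxB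
  obtain ⟨v, hv, hvx⟩ := exists_sub_adjugate_conj_eq A.1 A.2 hA.ne' (w - x)
    (by rw [trace_sub, hw, hx, sub_zero]) (by rw [sub_mul, trace_sub, hxA, sub_self])
  refine ⟨-u, v, by rw [trace_neg, hu, neg_zero], hv, ?_⟩
  change adjugate B.1 * -u * B.1 - -u + (v - adjugate A.1 * v * A.1) = w
  rw [hvx, mul_neg, neg_mul, neg_sub_neg, hux, add_sub_cancel]
end
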